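/- arXiv:2503.04423 — 3 statements merged into one kernel-verified Lean document; each statement's English description precedes it below -/
import Mathlib

section
/- Let S be a (finite) subgroup of the N-qubit Pauli group 𝒫_N with -1 ∉ S, and set P_S := (1/|S|) • ∑_{g ∈ S} g. Then P_S is an orthogonal projection, i.e. P_Sᴴ = P_S and P_S * P_S = P_S, and for every vector v ∈ ℂ^{2^N} one has P_S.mulVec v = v if and only if g.mulVec v = v for every g ∈ S (so the range of P_S is exactly the common +1-eigenspace V_S of S). -/
open Matrix

/-- The four Pauli matrices: `σ⁰ = 1`, `σ¹ = X`, `σ² = Y`, `σ³ = Z`. -/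
noncomputable def pauli : Fin 4 → Matrix (Fin 2) (Fin 2) ℂ :=
  ![1, !![0, 1; 1, 0], !![0, -Complex.I; Complex.I, 0], !![1, 0; 0, -1]]

/-- The `N`-qubit Pauli string `Σ^μ = σ^{μ 0} ⊗ ⋯ ⊗ σ^{μ (N-1)}`. -/
noncomputable def pauliString {N : ℕ} (μ : Fin N → Fin 4) :
    Matrix (Fin N → Fin 2) (Fin N → Fin 2) ℂ :=
  Matrix.of fun x y => ∏ i, pauli (μ i) (x i) (y i)

/-- The `N`-qubit Pauli group `𝒫_N`: matrices `c • Σ^μ` with `c ∈ {1, -1, i, -i}`. -/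
def pauliGroup (N : ℕ) : Set (Matrix (Fin N → Fin 2) (Fin N → Fin 2) ℂ) :=
  { M | ∃ c ∈ ({1, -1, Complex.I, -Complex.I} : Set ℂ),
      ∃ μ : Fin N → Fin 4, M = c • pauliString μ }

theorem pauli_isHermitian (k : Fin 4) : (pauli k).IsHermitian := by
  ext i j
  fin_cases k <;> fin_cases i <;> fin_cases j <;> simp [pauli]

theorem pauli_mul_self (k : Fin 4) : pauli k * pauli k = 1 := by
  ext i j
  fin_cases k <;> fin_cases i <;> fin_cases j <;> simp [pauli, Matrix.mul_apply]

theorem pauliString_isHermitian {N : ℕ} (μ : Fin N → Fin 4) : (pauliString μ).IsHermitian := by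
  ext x y
  simp only [pauliString, conjTranspose_apply, of_apply, star_prod]
  exact Finset.prod_congr rfl fun i _ => (pauli_isHermitian (μ i)).apply _ _

theorem pauliString_mul_self {N : ℕ} (μ : Fin N → Fin 4) :
    pauliString μ * pauliString μ = 1 := by
  ext x z
  calc (pauliString μ * pauliString μ) x z
      = ∏ i, ∑ j, pauli (μ i) (x i) j * pauli (μ i) j (z i) := by
        simp only [Matrix.mul_apply, pauliString, of_apply, ← Finset.prod_mul_distrib,
          Finset.prod_univ_sum, Fintype.piFinset_univ]
    _ = ∏ i, (1 : Matrix (Fin 2) (Fin 2) ℂ) (x i) (z i) := by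
        simp only [← Matrix.mul_apply, pauli_mul_self]
    _ = (1 : Matrix (Fin N → Fin 2) (Fin N → Fin 2) ℂ) x z := by
        simp only [Matrix.one_apply, Finset.prod_ite_zero, funext_iff, Finset.mem_univ,
          true_implies, Finset.prod_const_one]

theorem conjTranspose_mul_self_of_mem_pauliGroup {N : ℕ}
    {g : Matrix (Fin N → Fin 2) (Fin N → Fin 2) ℂ} (hg : g ∈ pauliGroup N) : gᴴ * g = 1 := by
  obtain ⟨c, hc, μ, rfl⟩ := hg
  have hcc : star c * c = 1 := by
    rcases hc with rfl | rfl | rfl | rfl <;> simp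
  rw [conjTranspose_smul, (pauliString_isHermitian μ).eq, smul_mul_smul_comm, hcc,
    pauliString_mul_self, one_smul]

/-- For a (finite) stabilizer group `S` (a subgroup of `𝒫_N` with `-1 ∉ S`), the
operator `P_S = (1/|S|) • ∑_{g ∈ S} g` is an orthogonal projection whose range is
exactly the common `+1`-eigenspace `V_S`. -/
theorem stabilizer_projector {N : ℕ} (hN : 1 ≤ N)
    (S : Finset (Matrix (Fin N → Fin 2) (Fin N → Fin 2) ℂ))
    (hSsub : (S : Set (Matrix (Fin N → Fin 2) (Fin N → Fin 2) ℂ)) ⊆ pauliGroup N)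
    (hone : (1 : Matrix (Fin N → Fin 2) (Fin N → Fin 2) ℂ) ∈ S)
    (hmul : ∀ g ∈ S, ∀ h ∈ S, g * h ∈ S)
    (hinv : ∀ g ∈ S, ∃ g' ∈ S, g * g' = 1)
    (hneg : -(1 : Matrix (Fin N → Fin 2) (Fin N → Fin 2) ℂ) ∉ S)
    (P : Matrix (Fin N → Fin 2) (Fin N → Fin 2) ℂ)
    (hP : P = ((S.card : ℂ))⁻¹ • ∑ g ∈ S, g) :
    Pᴴ = P ∧ P * P = P ∧
      ∀ v : (Fin N → Fin 2) → ℂ, P.mulVec v = v ↔ ∀ g ∈ S, g.mulVec v = v := by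
  have hunit : ∀ g ∈ S, gᴴ * g = 1 := fun g hg =>
    conjTranspose_mul_self_of_mem_pauliGroup (hSsub hg)
  have hstar : ∀ g ∈ S, gᴴ ∈ S := by
    intro g hg
    obtain ⟨g', hg', h⟩ := hinv g hg
    rwa [left_inv_eq_right_inv (hunit g hg) h]
  have hcard : (S.card : ℂ) ≠ 0 := by
    exact_mod_cast Finset.card_ne_zero_of_mem hone
  have hgP : ∀ g ∈ S, g * P = P := by
    intro g hg
    rw [hP, mul_smul_comm, Finset.mul_sum]
    congr 1
    refine Finset.sum_nbij' (g * ·) (gᴴ * ·) (fun h hh => hmul g hg h hh)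
      (fun h hh => hmul _ (hstar g hg) h hh) (fun h _ => ?_) (fun h _ => ?_) (fun _ _ => rfl)
    · rw [← Matrix.mul_assoc, hunit g hg, Matrix.one_mul]
    · rw [← Matrix.mul_assoc, mul_eq_one_comm.mp (hunit g hg), Matrix.one_mul]
  refine ⟨?_, ?_, fun v => ⟨fun hv g hg => ?_, fun hv => ?_⟩⟩
  · rw [hP, conjTranspose_smul, conjTranspose_sum, star_inv₀, star_natCast]
    congr 1
    exact Finset.sum_nbij' conjTranspose conjTranspose hstar hstar
      (fun g _ => conjTranspose_conjTranspose g) (fun g _ => conjTranspose_conjTranspose g)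
      (fun _ _ => rfl)
  · nth_rewrite 1 [hP]
    rw [smul_mul_assoc, Finset.sum_mul, Finset.sum_congr rfl hgP, Finset.sum_const,
      ← Nat.cast_smul_eq_nsmul ℂ, inv_smul_smul₀ hcard]
  · rw [← hv, mulVec_mulVec, hgP g hg]
  · rw [hP, smul_mulVec, sum_mulVec, Finset.sum_congr rfl hv, Finset.sum_const,
      ← Nat.cast_smul_eq_nsmul ℂ, inv_smul_smul₀ hcard]
end

section
/- Stabilizer states have vanishing stabilizer Rényi entropy: let S be a stabilizer group on N qubits with |S| = 2^N and let ψ ∈ ℂ^{2^N} be a unit vector with g.mulVec ψ = ψ for all g ∈ S. Then for every natural number n ≥ 1, ∑_{μ : Fin N → Fin 4} 2^{-N} · |⟨ψ, Σ^μ.mulVec ψ⟩|^{2n} = 1; in particular each expectation ⟨ψ, Σ^μ.mulVec ψ⟩ lies in {1, -1, 0}, and the stabilizer Rényi entropy M_n(ψ) = (1-n)^{-1} · log(∑_μ 2^{-N} ⟨ψ, Σ^μ.mulVec ψ⟩^{2n}) equals 0. -/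
open Matrix

/-- The standard Hermitian inner product `⟨u, v⟩ = ∑ x, conj (u x) * v x`. -/
noncomputable def hinner {ι : Type*} [Fintype ι] (u v : ι → ℂ) : ℂ :=
  ∑ x, (starRingEnd ℂ) (u x) * v x

lemma sum_pauli_mul_conj (a b c d : Fin 2) :
    ∑ k, pauli k a b * (starRingEnd ℂ) (pauli k c d) =
      if a = c ∧ b = d then 2 else 0 := by
  fin_cases a <;> fin_cases b <;> fin_cases c <;> fin_cases d <;>
    simp [pauli, Fin.sum_univ_four] <;> norm_num

lemma conj_pauli (k : Fin 4) (a b : Fin 2) :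
    (starRingEnd ℂ) (pauli k a b) = pauli k b a := by
  fin_cases k <;> fin_cases a <;> fin_cases b <;> simp [pauli]

lemma conj_pauliString {N : ℕ} (μ : Fin N → Fin 4) (x y : Fin N → Fin 2) :
    (starRingEnd ℂ) (pauliString μ x y) = pauliString μ y x := by
  simp [pauliString, conj_pauli]

/-- Completeness of the Pauli strings. -/
lemma sum_pauliString_mul_conj {N : ℕ} (x y z w : Fin N → Fin 2) :
    ∑ μ, pauliString μ x y * (starRingEnd ℂ) (pauliString μ z w) =
      if x = z ∧ y = w then 2 ^ N else 0 := by
  simp only [pauliString, Matrix.of_apply, map_prod, ← Finset.prod_mul_distrib]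
  rw [← Fintype.prod_sum fun i k => pauli k (x i) (y i) * (starRingEnd ℂ) (pauli k (z i) (w i))]
  simp only [sum_pauli_mul_conj]
  split_ifs with h
  · simp [h.1, h.2]
  · obtain ⟨i, hi⟩ : ∃ i, ¬(x i = z i ∧ y i = w i) := by
      by_contra! hc
      exact h ⟨funext fun i => (hc i).1, funext fun i => (hc i).2⟩
    exact Finset.prod_eq_zero (Finset.mem_univ i) (if_neg hi)

lemma hinner_mulVec {ι : Type*} [Fintype ι] (A : Matrix ι ι ℂ) (ψ : ι → ℂ) :
    hinner ψ (A.mulVec ψ) = ∑ p : ι × ι, (starRingEnd ℂ) (ψ p.1) * ψ p.2 * A p.1 p.2 := by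
  simp only [hinner, Matrix.mulVec, dotProduct, Fintype.sum_prod_type, Finset.mul_sum]
  exact Finset.sum_congr rfl fun x _ => Finset.sum_congr rfl fun y _ => by ring

lemma conj_hinner_pauliString {N : ℕ} (μ : Fin N → Fin 4) (ψ : (Fin N → Fin 2) → ℂ) :
    (starRingEnd ℂ) (hinner ψ ((pauliString μ).mulVec ψ)) =
      hinner ψ ((pauliString μ).mulVec ψ) := by
  rw [hinner_mulVec, map_sum]
  refine Fintype.sum_equiv (Equiv.prodComm _ _) _ _ fun p => ?_
  simp [conj_pauliString, mul_comm]

lemma hinner_self {ι : Type*} [Fintype ι] (ψ : ι → ℂ) :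
    hinner ψ ψ = ((∑ x, Complex.normSq (ψ x) : ℝ) : ℂ) := by
  simp [hinner, Complex.normSq_eq_conj_mul_self]

/-- The squared Pauli expectations of a vector sum to `2 ^ N` times the fourth power of its norm. -/
lemma sum_normSq_hinner_pauliString {N : ℕ} (ψ : (Fin N → Fin 2) → ℂ) :
    ∑ μ, Complex.normSq (hinner ψ ((pauliString μ).mulVec ψ)) =
      2 ^ N * (∑ x, Complex.normSq (ψ x)) ^ 2 := by
  apply Complex.ofReal_injective
  have expand : ∀ μ : Fin N → Fin 4,
      (Complex.normSq (hinner ψ ((pauliString μ).mulVec ψ)) : ℂ) =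
        ∑ p : (Fin N → Fin 2) × (Fin N → Fin 2), ∑ q : (Fin N → Fin 2) × (Fin N → Fin 2),
          ((starRingEnd ℂ) (ψ p.1) * ψ p.2 * (ψ q.1 * (starRingEnd ℂ) (ψ q.2))) *
            (pauliString μ p.1 p.2 * (starRingEnd ℂ) (pauliString μ q.1 q.2)) := by
    intro μ
    rw [← Complex.mul_conj, hinner_mulVec, map_sum, Finset.sum_mul_sum]
    refine Finset.sum_congr rfl fun p _ => Finset.sum_congr rfl fun q _ => ?_
    simp only [map_mul, Complex.conj_conj]
    ring
  rw [Complex.ofReal_sum, Finset.sum_congr rfl fun μ _ => expand μ, Finset.sum_comm]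
  have collapse : ∀ p : (Fin N → Fin 2) × (Fin N → Fin 2),
      ∑ μ : Fin N → Fin 4, ∑ q : (Fin N → Fin 2) × (Fin N → Fin 2),
          ((starRingEnd ℂ) (ψ p.1) * ψ p.2 * (ψ q.1 * (starRingEnd ℂ) (ψ q.2))) *
            (pauliString μ p.1 p.2 * (starRingEnd ℂ) (pauliString μ q.1 q.2)) =
        2 ^ N * ((Complex.normSq (ψ p.1) : ℂ) * Complex.normSq (ψ p.2)) := by
    intro p
    rw [Finset.sum_comm]
    simp only [← Finset.mul_sum, sum_pauliString_mul_conj, ← Prod.ext_iff, mul_ite, mul_zero,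
      Finset.sum_ite_eq, Finset.mem_univ, if_true, ← Complex.mul_conj]
    ring
  rw [Finset.sum_congr rfl fun p _ => collapse p, ← Finset.mul_sum, Fintype.sum_prod_type]
  simp only [← Finset.sum_mul_sum]
  push_cast
  ring

/-- A unit vector fixed by `c • A` satisfies `c * ⟨ψ, A ψ⟩ = 1`. -/
lemma mul_hinner_eq_one_of_smul_mulVec_eq {ι : Type*} [Fintype ι] {A : Matrix ι ι ℂ} {c : ℂ}
    {ψ : ι → ℂ} (hψ : ∑ x, Complex.normSq (ψ x) = 1) (h : (c • A).mulVec ψ = ψ) :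
    c * hinner ψ (A.mulVec ψ) = 1 := by
  have key : hinner ψ ((c • A).mulVec ψ) = 1 := by rw [h, hinner_self, hψ, Complex.ofReal_one]
  rw [← key, hinner_mulVec, hinner_mulVec, Finset.mul_sum]
  refine Finset.sum_congr rfl fun p _ => ?_
  simp only [Matrix.smul_apply, smul_eq_mul]
  ring

lemma normSq_eq_one_of_phase_mul_eq_one {c e : ℂ}
    (hc : c ∈ ({1, -1, Complex.I, -Complex.I} : Set ℂ)) (h : c * e = 1) :
    Complex.normSq e = 1 := by
  have hn : Complex.normSq c = 1 := by
    rcases hc with rfl | rfl | rfl | rfl <;> simp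
  simpa [hn] using congrArg Complex.normSq h

lemma eq_one_or_eq_neg_one_of_conj_eq {e : ℂ} (he : (starRingEnd ℂ) e = e)
    (h : Complex.normSq e = 1) : e = 1 ∨ e = -1 := by
  rw [← mul_self_eq_one_iff]
  have := Complex.mul_conj e
  rwa [he, h, Complex.ofReal_one] at this

/-- The squared expectation values of a stabilizer state are `0` or `1`. -/
lemma normSq_hinner_pauliString_eq_one_or_zero {N : ℕ}
    (S : Finset (Matrix (Fin N → Fin 2) (Fin N → Fin 2) ℂ))
    (hSsub : (S : Set (Matrix (Fin N → Fin 2) (Fin N → Fin 2) ℂ)) ⊆ pauliGroup N)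
    (hcard : S.card = 2 ^ N)
    (ψ : (Fin N → Fin 2) → ℂ) (hψ : ∑ x, Complex.normSq (ψ x) = 1)
    (hstab : ∀ g ∈ S, g.mulVec ψ = ψ) (μ : Fin N → Fin 4) :
    Complex.normSq (hinner ψ ((pauliString μ).mulVec ψ)) = 1 ∨
      Complex.normSq (hinner ψ ((pauliString μ).mulVec ψ)) = 0 := by
  have decompose : ∀ g : S, ∃ c ∈ ({1, -1, Complex.I, -Complex.I} : Set ℂ),
      ∃ ν : Fin N → Fin 4, (g : Matrix _ _ ℂ) = c • pauliString ν := fun g => hSsub g.2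
  choose c hc ν hν using decompose
  have hphase : ∀ g, c g * hinner ψ ((pauliString (ν g)).mulVec ψ) = 1 := fun g =>
    mul_hinner_eq_one_of_smul_mulVec_eq hψ (hν g ▸ hstab g g.2)
  have hinj : Function.Injective ν := by
    intro g h hgh
    have hg := hphase g
    have hh := hphase h
    rw [hgh] at hg
    have hcc : c g = c h := mul_right_cancel₀ (right_ne_zero_of_mul_eq_one hh) (hg.trans hh.symm)
    exact Subtype.ext (by rw [hν g, hν h, hcc, hgh])
  have hone : ∀ κ ∈ Finset.univ.image ν,
      Complex.normSq (hinner ψ ((pauliString κ).mulVec ψ)) = 1 := by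
    intro κ hκ
    obtain ⟨g, -, rfl⟩ := Finset.mem_image.mp hκ
    exact normSq_eq_one_of_phase_mul_eq_one (hc g) (hphase g)
  have himage : ∑ κ ∈ Finset.univ.image ν,
      Complex.normSq (hinner ψ ((pauliString κ).mulVec ψ)) = 2 ^ N := by
    rw [Finset.sum_congr rfl hone]
    simp [Finset.card_image_of_injective _ hinj, hcard]
  by_cases hμ : μ ∈ Finset.univ.image ν
  · exact Or.inl (hone μ hμ)
  · right
    have hcompl := Finset.sum_add_sum_compl (Finset.univ.image ν)
      fun κ => Complex.normSq (hinner ψ ((pauliString κ).mulVec ψ))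
    rw [himage, sum_normSq_hinner_pauliString, hψ, one_pow, mul_one, add_eq_left,
      Finset.sum_eq_zero_iff_of_nonneg fun κ _ => Complex.normSq_nonneg _] at hcompl
    exact hcompl μ (Finset.mem_compl.mpr hμ)

/-- Stabilizer states have vanishing stabilizer Rényi entropy: for a stabilizer state
`ψ` (stabilized by a stabilizer group of size `2^N`), each Pauli expectation lies in
`{1, -1, 0}`, all the sums `∑_μ 2^{-N} |⟨ψ, Σ^μ ψ⟩|^{2n}` equal `1`, and the
stabilizer Rényi entropy `M_n(ψ)` vanishes for every `n ≥ 1`. -/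
theorem stabilizer_state_SRE_eq_zero {N : ℕ} (hN : 1 ≤ N)
    (S : Finset (Matrix (Fin N → Fin 2) (Fin N → Fin 2) ℂ))
    (hSsub : (S : Set (Matrix (Fin N → Fin 2) (Fin N → Fin 2) ℂ)) ⊆ pauliGroup N)
    (hone : (1 : Matrix (Fin N → Fin 2) (Fin N → Fin 2) ℂ) ∈ S)
    (hmul : ∀ g ∈ S, ∀ h ∈ S, g * h ∈ S)
    (hinv : ∀ g ∈ S, ∃ g' ∈ S, g * g' = 1)
    (hneg : -(1 : Matrix (Fin N → Fin 2) (Fin N → Fin 2) ℂ) ∉ S)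
    (hcard : S.card = 2 ^ N)
    (ψ : (Fin N → Fin 2) → ℂ) (hψ : ∑ x, Complex.normSq (ψ x) = 1)
    (hstab : ∀ g ∈ S, g.mulVec ψ = ψ) :
    (∀ μ : Fin N → Fin 4,
        hinner ψ ((pauliString μ).mulVec ψ) = 1 ∨
        hinner ψ ((pauliString μ).mulVec ψ) = -1 ∨
        hinner ψ ((pauliString μ).mulVec ψ) = 0) ∧
    ∀ n : ℕ, 1 ≤ n →
      (∑ μ : Fin N → Fin 4, ((2 : ℝ) ^ N)⁻¹ *
          Complex.normSq (hinner ψ ((pauliString μ).mulVec ψ)) ^ n) = 1 ∧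
      (1 - (n : ℝ))⁻¹ *
          Real.log (∑ μ : Fin N → Fin 4, ((2 : ℝ) ^ N)⁻¹ *
            Complex.normSq (hinner ψ ((pauliString μ).mulVec ψ)) ^ n) = 0 := by
  have hdich := normSq_hinner_pauliString_eq_one_or_zero S hSsub hcard ψ hψ hstab
  have hsum : ∀ n : ℕ, 1 ≤ n → (∑ μ : Fin N → Fin 4, ((2 : ℝ) ^ N)⁻¹ *
      Complex.normSq (hinner ψ ((pauliString μ).mulVec ψ)) ^ n) = 1 := by
    intro n hn
    have hpow : ∀ μ : Fin N → Fin 4,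
        Complex.normSq (hinner ψ ((pauliString μ).mulVec ψ)) ^ n =
          Complex.normSq (hinner ψ ((pauliString μ).mulVec ψ)) := by
      intro μ
      rcases hdich μ with h | h <;> rw [h]
      · exact one_pow n
      · exact zero_pow (by omega)
    simp only [hpow, ← Finset.mul_sum, sum_normSq_hinner_pauliString, hψ]
    simp
  refine ⟨fun μ => ?_, fun n hn => ⟨hsum n hn, by rw [hsum n hn, Real.log_one, mul_zero]⟩⟩
  rcases hdich μ with h | h
  · rcases eq_one_or_eq_neg_one_of_conj_eq (conj_hinner_pauliString μ ψ) h with h | h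
    · exact Or.inl h
    · exact Or.inr (Or.inl h)
  · exact Or.inr (Or.inr (Complex.normSq_eq_zero.mp h))
end

section
/- The stabilizer Rényi entropy is additive under tensor products: for unit vectors ψ ∈ ℂ^{2^N} and φ ∈ ℂ^{2^M}, every natural number n ≥ 1 satisfies ∑_{μ : Fin N → Fin 4} ∑_{ν : Fin M → Fin 4} |⟨ψ ⊗ φ, (Σ^μ ⊗ Σ^ν).mulVec (ψ ⊗ φ)⟩|^{2n} = (∑_{μ} |⟨ψ, Σ^μ.mulVec ψ⟩|^{2n}) · (∑_{ν} |⟨φ, Σ^ν.mulVec φ⟩|^{2n}), where ⊗ denotes the Kronecker product of matrices and of vectors; consequently M_n(ψ ⊗ φ) = M_n(ψ) + M_n(φ) for the stabilizer Rényi entropies M_n. -/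
open Matrix Kronecker

/-- The Kronecker (tensor) product of two vectors. -/
noncomputable def vecKron {ι κ : Type*} (u : ι → ℂ) (v : κ → ℂ) : ι × κ → ℂ :=
  fun p => u p.1 * v p.2

/-- Expectation values of Kronecker products in product vectors factorize. -/
theorem hinner_vecKron_kronecker_mulVec {ι κ : Type*} [Fintype ι] [Fintype κ]
    (A : Matrix ι ι ℂ) (B : Matrix κ κ ℂ) (u : ι → ℂ) (v : κ → ℂ) :
    hinner (vecKron u v) ((A ⊗ₖ B).mulVec (vecKron u v)) =
      hinner u (A.mulVec u) * hinner v (B.mulVec v) := by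
  have hmul : (A ⊗ₖ B).mulVec (vecKron u v) = vecKron (A.mulVec u) (B.mulVec v) := by
    ext p
    simp only [Matrix.mulVec, dotProduct, vecKron, Finset.sum_mul_sum, Fintype.sum_prod_type,
      Matrix.kroneckerMap_apply]
    exact Finset.sum_congr rfl fun _ _ => Finset.sum_congr rfl fun _ _ => by ring
  rw [hmul]
  simp only [hinner, vecKron, Finset.sum_mul_sum, Fintype.sum_prod_type, map_mul]
  exact Finset.sum_congr rfl fun _ _ => Finset.sum_congr rfl fun _ _ => by ring

theorem pauliString_zero (N : ℕ) : pauliString (0 : Fin N → Fin 4) = 1 := by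
  ext x y
  simp [pauliString, pauli, Matrix.one_apply, Finset.prod_ite_zero, funext_iff]

/-- The identity string contributes `1`, so the Pauli expectation sum of a unit vector is
positive. -/
theorem sum_normSq_hinner_pauliString_pow_pos {N : ℕ} (ψ : (Fin N → Fin 2) → ℂ)
    (hψ : ∑ x, Complex.normSq (ψ x) = 1) (n : ℕ) :
    0 < ∑ μ : Fin N → Fin 4, Complex.normSq (hinner ψ ((pauliString μ).mulVec ψ)) ^ n := by
  refine Finset.sum_pos' (fun _ _ => pow_nonneg (Complex.normSq_nonneg _) n)
    ⟨0, Finset.mem_univ _, ?_⟩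
  have hnorm : hinner ψ ψ = 1 := by
    simp only [hinner, ← Complex.normSq_eq_conj_mul_self]
    exact_mod_cast hψ
  simp [pauliString_zero, hnorm]

/-- Additivity of the stabilizer Rényi entropy under tensor products: the Pauli
expectation sums factorize, and consequently `M_n(ψ ⊗ φ) = M_n(ψ) + M_n(φ)`. -/
theorem SRE_additive {N M : ℕ} (hN : 1 ≤ N) (hM : 1 ≤ M)
    (ψ : (Fin N → Fin 2) → ℂ) (hψ : ∑ x, Complex.normSq (ψ x) = 1)
    (φ : (Fin M → Fin 2) → ℂ) (hφ : ∑ x, Complex.normSq (φ x) = 1)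
    (n : ℕ) (hn : 1 ≤ n) :
    (∑ μ : Fin N → Fin 4, ∑ ν : Fin M → Fin 4,
        Complex.normSq (hinner (vecKron ψ φ)
          ((pauliString μ ⊗ₖ pauliString ν).mulVec (vecKron ψ φ))) ^ n) =
      (∑ μ : Fin N → Fin 4,
        Complex.normSq (hinner ψ ((pauliString μ).mulVec ψ)) ^ n) *
      (∑ ν : Fin M → Fin 4,
        Complex.normSq (hinner φ ((pauliString ν).mulVec φ)) ^ n) ∧
    (1 - (n : ℝ))⁻¹ *
        Real.log (((2 : ℝ) ^ (N + M))⁻¹ * ∑ μ : Fin N → Fin 4, ∑ ν : Fin M → Fin 4,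
          Complex.normSq (hinner (vecKron ψ φ)
            ((pauliString μ ⊗ₖ pauliString ν).mulVec (vecKron ψ φ))) ^ n) =
      (1 - (n : ℝ))⁻¹ *
          Real.log (((2 : ℝ) ^ N)⁻¹ * ∑ μ : Fin N → Fin 4,
            Complex.normSq (hinner ψ ((pauliString μ).mulVec ψ)) ^ n) +
      (1 - (n : ℝ))⁻¹ *
          Real.log (((2 : ℝ) ^ M)⁻¹ * ∑ ν : Fin M → Fin 4,
            Complex.normSq (hinner φ ((pauliString ν).mulVec φ)) ^ n) := by
  have hfactor : (∑ μ : Fin N → Fin 4, ∑ ν : Fin M → Fin 4,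
        Complex.normSq (hinner (vecKron ψ φ)
          ((pauliString μ ⊗ₖ pauliString ν).mulVec (vecKron ψ φ))) ^ n) =
      (∑ μ : Fin N → Fin 4,
        Complex.normSq (hinner ψ ((pauliString μ).mulVec ψ)) ^ n) *
      (∑ ν : Fin M → Fin 4,
        Complex.normSq (hinner φ ((pauliString ν).mulVec φ)) ^ n) := by
    simp only [hinner_vecKron_kronecker_mulVec, map_mul, mul_pow, Finset.sum_mul_sum]
  refine ⟨hfactor, ?_⟩
  have hposψ := sum_normSq_hinner_pauliString_pow_pos ψ hψ n
  have hposφ := sum_normSq_hinner_pauliString_pow_pos φ hφ n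
  rw [hfactor, pow_add, mul_inv, mul_mul_mul_comm,
    Real.log_mul (by positivity) (by positivity), mul_add]
end
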